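/- Characterization of OT_p-convergence: for μ, μ₁, μ₂, … in M^p with 1 ≤ p < ∞, OT_p(μ_n, μ) → 0 if and only if μ_n converges vaguely to μ (i.e., μ_n(f) → μ(f) for all continuous compactly supported f : Ω → ℝ) and Pers_p(μ_n) → Pers_p(μ). -/

import Mathlib

noncomputable section

open MeasureTheory Metric Set Filter Topology ENNReal
open scoped Classical

/-- The plane with the Euclidean distance. -/
abbrev Pt : Type := EuclideanSpace ℝ (Fin 2)

/-- Build a point of the plane from coordinates. -/
def mk2 (a b : ℝ) : Pt := (WithLp.equiv 2 (Fin 2 → ℝ)).symm ![a, b]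

/-- The open upper half-plane Ω = {(t₁,t₂) : t₂ > t₁}. -/
def UHP : Set Pt := {x | x 0 < x 1}

/-- The diagonal ∂Ω = {(t,t)}. -/
def Diag : Set Pt := {x | x 0 = x 1}

/-- Ω̄ = Ω ∪ ∂Ω. -/
def UHPbar : Set Pt := UHP ∪ Diag

/-- Distance from a point to the diagonal. -/
def persDist (x : Pt) : ℝ := infDist x Diag

/-- p-th total persistence Pers_p(μ) = ∫_Ω d(x,∂Ω)^p dμ(x). -/
def Pers (p : ℝ) (μ : Measure Pt) : ℝ≥0∞ :=
  ∫⁻ x in UHP, ENNReal.ofReal (persDist x ^ p) ∂μ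

/-- μ ∈ M^p : a measure supported on Ω with finite p-th persistence. -/
def MemMp (p : ℝ) (μ : Measure Pt) : Prop := μ UHPᶜ = 0 ∧ Pers p μ < ⊤

/-- Admissible partial transport plans between μ and ν: measures on Ω̄ × Ω̄ whose
marginals restricted to Ω are μ and ν. -/
def Adm (μ ν : Measure Pt) : Set (Measure (Pt × Pt)) :=
  {π | π ((UHPbar ×ˢ UHPbar)ᶜ) = 0 ∧
    (∀ A : Set Pt, MeasurableSet A → A ⊆ UHP → π (A ×ˢ univ) = μ A) ∧
    (∀ B : Set Pt, MeasurableSet B → B ⊆ UHP → π (univ ×ˢ B) = ν B)}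

/-- Cost C_p(π) = ∬ d(x,y)^p dπ(x,y). -/
def Cost (p : ℝ) (π : Measure (Pt × Pt)) : ℝ≥0∞ :=
  ∫⁻ z, ENNReal.ofReal (dist z.1 z.2 ^ p) ∂π

/-- OT_p(μ,ν)^p, as an extended real. -/
def OTe (p : ℝ) (μ ν : Measure Pt) : ℝ≥0∞ := ⨅ π ∈ Adm μ ν, Cost p π

/-- The optimal partial transport distance OT_p(μ,ν). -/
def OT (p : ℝ) (μ ν : Measure Pt) : ℝ := (OTe p μ ν ^ (1 / p)).toReal

/-- Optimal plans. -/
def OptSet (p : ℝ) (μ ν : Measure Pt) : Set (Measure (Pt × Pt)) :=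
  {π | π ∈ Adm μ ν ∧ Cost p π = OTe p μ ν}

/-- Vague convergence of measures on Ω: convergence of integrals of continuous
functions compactly supported in Ω. -/
def VagueTendsto (μs : ℕ → Measure Pt) (μ : Measure Pt) : Prop :=
  ∀ f : Pt → ℝ, Continuous f → HasCompactSupport f → tsupport f ⊆ UHP →
    Tendsto (fun n => ∫ x, f x ∂(μs n)) atTop (𝓝 (∫ x, f x ∂μ))

/-- E_Ω = (Ω̄ × Ω̄) \ (∂Ω × ∂Ω). -/
def EOm : Set (Pt × Pt) := (UHPbar ×ˢ UHPbar) \ (Diag ×ˢ Diag)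

/-- Vague convergence of plans on E_Ω. -/
def VaguePlanTendsto (πs : ℕ → Measure (Pt × Pt)) (π : Measure (Pt × Pt)) : Prop :=
  ∀ f : Pt × Pt → ℝ, Continuous f → HasCompactSupport f → tsupport f ⊆ EOm →
    Tendsto (fun n => ∫ z, f z ∂(πs n)) atTop (𝓝 (∫ z, f z ∂π))

/-- A persistence diagram: an ℕ-valued point measure Σ_{x ∈ X} n_x δ_x with
X ⊆ Ω locally finite in Ω. -/
def IsDiagram (μ : Measure Pt) : Prop :=
  ∃ (X : Set Pt) (n : Pt → ℕ), X ⊆ UHP ∧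
    (∀ x ∈ UHP, ∃ U ∈ 𝓝 x, (X ∩ U).Finite) ∧
    μ = Measure.sum (fun x : X => (n x.1 : ℝ≥0∞) • Measure.dirac (x.1 : Pt))

/-- Support of a measure on Pt × Pt. -/
def msupp (π : Measure (Pt × Pt)) : Set (Pt × Pt) := {z | ∀ U ∈ 𝓝 z, π U ≠ 0}

/-- Support of a measure on Pt. -/
def suppM (μ : Measure Pt) : Set Pt := {x | ∀ U ∈ 𝓝 x, μ U ≠ 0}

/-- Bottleneck cost of a plan: sup of d(x,y) over the support. -/
def CostInf (π : Measure (Pt × Pt)) : ℝ≥0∞ :=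
  ⨆ z ∈ msupp π, ENNReal.ofReal (dist z.1 z.2)

/-- The bottleneck (∞) optimal partial transport distance, as extended real. -/
def OTinfE (μ ν : Measure Pt) : ℝ≥0∞ := ⨅ π ∈ Adm μ ν, CostInf π

/-- μ ∈ M^∞ : support at bounded distance from the diagonal. -/
def MemMinf (μ : Measure Pt) : Prop :=
  μ UHPᶜ = 0 ∧ ∃ C : ℝ, ∀ x ∈ suppM μ, persDist x ≤ C

/-- A partial matching between two indexed families: a bijection between
subsets of the index sets; unmatched points are sent to the diagonal. -/
structure Matching (ι κ : Type*) where
  I : Set ι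
  J : Set κ
  e : I ≃ J

/-- Cost of a partial matching for d_p (as the p-th power, extended real). -/
def mCost (p : ℝ) {ι κ : Type*} (x : ι → Pt) (y : κ → Pt) (m : Matching ι κ) : ℝ≥0∞ :=
  (∑' i : m.I, ENNReal.ofReal (dist (x i.1) (y (m.e i).1) ^ p))
  + (∑' i : ↥(m.Iᶜ), ENNReal.ofReal (persDist (x i.1) ^ p))
  + (∑' j : ↥(m.Jᶜ), ENNReal.ofReal (persDist (y j.1) ^ p))

/-- Bottleneck cost of a partial matching. -/
def mCostInf {ι κ : Type*} (x : ι → Pt) (y : κ → Pt) (m : Matching ι κ) : ℝ≥0∞ :=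
  (⨆ i : m.I, ENNReal.ofReal (dist (x i.1) (y (m.e i).1)))
  ⊔ (⨆ i : ↥(m.Iᶜ), ENNReal.ofReal (persDist (x i.1)))
  ⊔ (⨆ j : ↥(m.Jᶜ), ENNReal.ofReal (persDist (y j.1)))

/-- The point measure associated to an indexed family of points. -/
def famMeasure {ι : Type*} (x : ι → Pt) : Measure Pt :=
  Measure.sum (fun i => Measure.dirac (x i))

/-- The weighted measure μ^p, with density d(x,∂Ω)^p with respect to μ. -/
def wgt (p : ℝ) (μ : Measure Pt) : Measure Pt :=
  μ.withDensity (fun x => ENNReal.ofReal (persDist x ^ p))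

/-- The quotient space Ω̃ = Ω ⊔ {∂Ω}. -/
def Qt : Type := Option ↥UHP

/-- The quotient metric ρ on Ω̃. -/
def ρQ : Qt → Qt → ℝ
  | some x, some y => min (dist (x : Pt) (y : Pt)) (persDist x + persDist y)
  | some x, none => persDist x
  | none, some y => persDist y
  | none, none => 0

/-- The quotient metric ρ viewed on the plane, all diagonal points being
identified. -/
def ρP (x y : Pt) : ℝ :=
  if x ∈ Diag then (if y ∈ Diag then 0 else persDist y)
  else if y ∈ Diag then persDist x
  else min (dist x y) (persDist x + persDist y)

/-- Couplings with full (equal-mass) marginals. -/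
def Coup (μ ν : Measure Pt) : Set (Measure (Pt × Pt)) :=
  {π | π.map Prod.fst = μ ∧ π.map Prod.snd = ν}

/-- The p-Wasserstein distance (to the p) for the quotient metric ρ. -/
def WpE (p : ℝ) (μ ν : Measure Pt) : ℝ≥0∞ :=
  ⨅ π ∈ Coup μ ν, ∫⁻ z, ENNReal.ofReal (ρP z.1 z.2 ^ p) ∂π



lemma cont_coord (i : Fin 2) : Continuous (fun x : Pt => x i) := by fun_prop

lemma isOpen_UHP : IsOpen UHP := isOpen_lt (cont_coord 0) (cont_coord 1)

lemma isClosed_Diag : IsClosed Diag := isClosed_eq (cont_coord 0) (cont_coord 1)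

lemma measurableSet_UHPbar : MeasurableSet UHPbar :=
  isOpen_UHP.measurableSet.union isClosed_Diag.measurableSet

lemma Diag_nonempty : Diag.Nonempty := ⟨0, by simp [Diag]⟩

lemma persDist_nonneg (x : Pt) : 0 ≤ persDist x := infDist_nonneg

lemma continuous_persDist : Continuous persDist := continuous_infDist_pt _

lemma persDist_Diag {x : Pt} (hx : x ∈ Diag) : persDist x = 0 := infDist_zero_of_mem hx

lemma persDist_pos {x : Pt} (hx : x ∈ UHP) : 0 < persDist x := by
  refine (infDist_pos_iff_notMem_closure Diag_nonempty).1 ?_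
  rw [isClosed_Diag.closure_eq]
  intro h
  simp only [UHP, Diag, mem_ofPred_eq] at hx h
  linarith

lemma persDist_le (x y : Pt) : persDist x ≤ persDist y + dist x y := infDist_le_infDist_add_dist

/-- orthogonal projection on the diagonal -/
def prD (x : Pt) : Pt := mk2 ((x 0 + x 1) / 2) ((x 0 + x 1) / 2)

lemma prD_mem (x : Pt) : prD x ∈ Diag := by simp [prD, Diag, mk2]

lemma continuous_prD : Continuous prD := by
  unfold prD mk2
  apply (PiLp.continuous_toLp 2 _).comp
  refine continuous_pi fun i => ?_
  fin_cases i <;> simp <;> fun_prop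

lemma dist_prD (x : Pt) : dist x (prD x) ≤ persDist x := by
  refine (le_infDist Diag_nonempty).2 ?_
  intro y hy
  simp only [Diag, mem_ofPred_eq] at hy
  rw [EuclideanSpace.dist_eq, EuclideanSpace.dist_eq]
  apply Real.sqrt_le_sqrt
  simp only [Fin.sum_univ_two, Real.dist_eq, sq_abs, prD, mk2, WithLp.equiv_symm_apply,
    Matrix.cons_val_zero, Matrix.cons_val_one]
  rw [hy]
  nlinarith [sq_nonneg (x 0 + x 1 - 2 * y 1)]

/-- the weight -/
def wt (p : ℝ) (x : Pt) : ℝ≥0∞ := ENNReal.ofReal (persDist x ^ p)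

lemma measurable_wt (p : ℝ) : Measurable (wt p) := by
  unfold wt
  have := continuous_persDist.measurable
  fun_prop

lemma Pers_eq {p : ℝ} {μ : Measure Pt} (h : μ UHPᶜ = 0) : Pers p μ = ∫⁻ x, wt p x ∂μ := by
  unfold Pers
  rw [Measure.restrict_eq_self_of_ae_mem]
  · rfl
  · exact h

/-- swapping plans -/
lemma Adm_swap {μ ν : Measure Pt} {π : Measure (Pt × Pt)} (h : π ∈ Adm μ ν) :
    π.map Prod.swap ∈ Adm ν μ := by
  obtain ⟨h1, h2, h3⟩ := h
  refine ⟨?_, ?_, ?_⟩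
  · rw [Measure.map_apply measurable_swap
      (measurableSet_UHPbar.prod measurableSet_UHPbar).compl]
    rw [preimage_compl, preimage_swap_prod]; exact h1
  · intro A hA hAU
    rw [Measure.map_apply measurable_swap (hA.prod MeasurableSet.univ), preimage_swap_prod]
    exact h3 A hA hAU
  · intro A hA hAU
    rw [Measure.map_apply measurable_swap (MeasurableSet.univ.prod hA), preimage_swap_prod]
    exact h2 A hA hAU

lemma Cost_swap (p : ℝ) (π : Measure (Pt × Pt)) : Cost p (π.map Prod.swap) = Cost p π := by
  unfold Cost
  rw [lintegral_map (by fun_prop) measurable_swap]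
  simp [dist_comm]

lemma OTe_comm_le (p : ℝ) (μ ν : Measure Pt) : OTe p μ ν ≤ OTe p ν μ := by
  refine le_iInf₂ fun π hπ => ?_
  rw [← Cost_swap]
  exact iInf₂_le _ (Adm_swap hπ)

lemma OTe_comm (p : ℝ) (μ ν : Measure Pt) : OTe p μ ν = OTe p ν μ :=
  le_antisymm (OTe_comm_le _ _ _) (OTe_comm_le _ _ _)

lemma Adm_restrict {μ ν : Measure Pt} {π : Measure (Pt × Pt)} (h : π ∈ Adm μ ν) :
    (π.map Prod.fst).restrict UHP = μ.restrict UHP := by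
  ext A hA
  rw [Measure.restrict_apply hA, Measure.restrict_apply hA,
    Measure.map_apply measurable_fst (hA.inter isOpen_UHP.measurableSet),
    ← h.2.1 _ (hA.inter isOpen_UHP.measurableSet) inter_subset_right]
  congr 1
  ext z; simp

lemma Adm_ae {μ ν : Measure Pt} {π : Measure (Pt × Pt)} (h : π ∈ Adm μ ν) :
    ∀ᵐ z ∂π, z.1 ∈ UHPbar ∧ z.2 ∈ UHPbar := by
  have := h.1
  exact this

lemma Adm_wt_fst {p : ℝ} (hp : 0 < p) {μ ν : Measure Pt} {π : Measure (Pt × Pt)}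
    (h : π ∈ Adm μ ν) :
    ∫⁻ z, wt p z.1 ∂π = Pers p μ := by
  have e1 : ∫⁻ z, wt p z.1 ∂π = ∫⁻ z, UHP.indicator (wt p) z.1 ∂π := by
    refine lintegral_congr_ae ?_
    filter_upwards [Adm_ae h] with z hz
    by_cases hU : z.1 ∈ UHP
    · simp [hU]
    · have : z.1 ∈ Diag := by
        rcases hz.1 with h | h
        · exact absurd h hU
        · exact h
      simp [hU, wt, persDist_Diag this, Real.zero_rpow hp.ne']
  rw [e1, ← lintegral_map ((measurable_wt p).indicator isOpen_UHP.measurableSet) measurable_fst,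
    lintegral_indicator isOpen_UHP.measurableSet, Adm_restrict h]
  rfl

lemma Adm_wt_snd {p : ℝ} (hp : 0 < p) {μ ν : Measure Pt} {π : Measure (Pt × Pt)}
    (h : π ∈ Adm μ ν) :
    ∫⁻ z, wt p z.2 ∂π = Pers p ν := by
  rw [← Adm_wt_fst hp (Adm_swap h), lintegral_map _ measurable_swap]
  · rfl
  · exact (measurable_wt p).comp measurable_fst

lemma Pers_le_OTe {p : ℝ} (hp : 1 ≤ p) {μ ν : Measure Pt} :
    Pers p μ ^ (1 / p) ≤ Pers p ν ^ (1 / p) + OTe p μ ν ^ (1 / p) := by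
  have hp0 : 0 < p := by linarith
  have key : ∀ π ∈ Adm μ ν,
      Pers p μ ^ (1 / p) ≤ Pers p ν ^ (1 / p) + Cost p π ^ (1 / p) := by
    intro π hπ
    have hm := continuous_persDist.measurable
    have := ENNReal.lintegral_Lp_add_le (μ := π) (p := p)
      (f := fun z => ENNReal.ofReal (persDist z.2)) (g := fun z => ENNReal.ofReal (dist z.1 z.2))
      (by fun_prop) (by fun_prop) hp
    refine le_trans ?_ (this.trans_eq ?_)
    · rw [← Adm_wt_fst hp0 hπ]
      gcongr with z
      unfold wt
      rw [← ENNReal.ofReal_rpow_of_nonneg (persDist_nonneg _) hp0.le]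
      gcongr
      simp only [Pi.add_apply]
      rw [← ENNReal.ofReal_add (persDist_nonneg _) dist_nonneg]
      exact ENNReal.ofReal_le_ofReal (persDist_le _ _)
    · rw [← Adm_wt_snd hp0 hπ]
      unfold wt Cost
      simp_rw [ENNReal.ofReal_rpow_of_nonneg (persDist_nonneg _) hp0.le,
        ENNReal.ofReal_rpow_of_nonneg dist_nonneg hp0.le]
  rw [← tsub_le_iff_left, one_div, ENNReal.le_rpow_inv_iff hp0]
  refine le_iInf₂ fun π hπ => ?_
  rw [← ENNReal.le_rpow_inv_iff hp0, ← one_div, tsub_le_iff_left]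
  exact key π hπ

lemma Pers_tendsto {p : ℝ} (hp : 1 ≤ p) {μ : Measure Pt} {μs : ℕ → Measure Pt}
    (hμ : Pers p μ < ⊤) (h : Tendsto (fun n => OTe p (μs n) μ) atTop (𝓝 0)) :
    Tendsto (fun n => Pers p (μs n)) atTop (𝓝 (Pers p μ)) := by
  have hp0 : 0 < p := by linarith
  have h1 : Tendsto (fun n => OTe p (μs n) μ ^ (1 / p)) atTop (𝓝 0) := by
    have := (ENNReal.continuous_rpow_const (y := 1 / p)).tendsto 0 |>.comp h
    simpa [hp0, Function.comp_def] using this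
  have hfin : Pers p μ ^ (1 / p) ≠ ⊤ := by
    apply ENNReal.rpow_ne_top_of_nonneg (by positivity) hμ.ne
  have h2 : Tendsto (fun n => Pers p (μs n) ^ (1 / p)) atTop (𝓝 (Pers p μ ^ (1 / p))) := by
    have u : Tendsto (fun n => Pers p μ ^ (1 / p) + OTe p (μs n) μ ^ (1 / p)) atTop
        (𝓝 (Pers p μ ^ (1 / p))) := by
      simpa using (tendsto_const_nhds (x := Pers p μ ^ (1 / p))).add h1
    have l : Tendsto (fun n => Pers p μ ^ (1 / p) - OTe p (μs n) μ ^ (1 / p)) atTop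
        (𝓝 (Pers p μ ^ (1 / p))) := by
      simpa using ENNReal.Tendsto.sub (tendsto_const_nhds (x := Pers p μ ^ (1 / p))) h1
        (Or.inl hfin)
    refine tendsto_of_tendsto_of_tendsto_of_le_of_le l u (fun n => ?_) (fun n => Pers_le_OTe hp)
    simp only [tsub_le_iff_right]
    rw [OTe_comm]
    exact Pers_le_OTe hp
  have := (ENNReal.continuous_rpow_const (y := p)).tendsto _ |>.comp h2
  simpa [Function.comp_def, ← ENNReal.rpow_mul, hp0.ne'] using this

lemma vague_pointwise {p : ℝ} (hp : 1 ≤ p) {f : Pt → ℝ} (hf : Continuous f)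
    (hc : HasCompactSupport f) (hs : tsupport f ⊆ UHP) {κ : ℝ} (hκ : 0 < κ) :
    ∃ C : ℝ, 0 ≤ C ∧ ∀ x y, |f x - f y| ≤
      κ * (persDist x ^ p + persDist y ^ p) + C * dist x y ^ p := by
  have hp0 : 0 < p := by linarith
  obtain ⟨c, hc0, hcle⟩ := IsCompact.exists_forall_le' (f := persDist) (s := tsupport f) hc
    continuous_persDist.continuousOn (a := 0) (fun b hb => persDist_pos (hs hb))
  obtain ⟨M, hM⟩ := hf.bounded_above_of_compact_support hc
  have hM0 : 0 ≤ M := (norm_nonneg _).trans (hM 0)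
  have hu : UniformContinuous f := hc.uniformContinuous_of_continuous hf
  have hcp : 0 < c ^ p := Real.rpow_pos_of_pos hc0 p
  obtain ⟨δ, hδ, hδf⟩ := Metric.uniformContinuous_iff.1 hu (κ * c ^ p) (by positivity)
  have hδp : 0 < δ ^ p := Real.rpow_pos_of_pos hδ p
  refine ⟨2 * M / δ ^ p, by positivity, fun x y => ?_⟩
  have hx0 : 0 ≤ persDist x ^ p := Real.rpow_nonneg (persDist_nonneg _) _
  have hy0 : 0 ≤ persDist y ^ p := Real.rpow_nonneg (persDist_nonneg _) _
  have hd0 : 0 ≤ dist x y ^ p := Real.rpow_nonneg dist_nonneg _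
  by_cases hxy : dist x y < δ
  · have h0 : 0 ≤ 2 * M / δ ^ p * dist x y ^ p := by positivity
    have h1 := (hδf hxy).le
    rw [Real.dist_eq] at h1
    by_cases hx : x ∈ tsupport f
    · have : c ^ p ≤ persDist x ^ p := Real.rpow_le_rpow hc0.le (hcle x hx) hp0.le
      nlinarith [mul_le_mul_of_nonneg_left this hκ.le, mul_nonneg hκ.le hy0]
    by_cases hy : y ∈ tsupport f
    · have : c ^ p ≤ persDist y ^ p := Real.rpow_le_rpow hc0.le (hcle y hy) hp0.le
      nlinarith [mul_le_mul_of_nonneg_left this hκ.le, mul_nonneg hκ.le hx0]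
    rw [image_eq_zero_of_notMem_tsupport hx, image_eq_zero_of_notMem_tsupport hy]
    simp only [sub_self, abs_zero]
    positivity
  · push Not at hxy
    have h1 : δ ^ p ≤ dist x y ^ p := Real.rpow_le_rpow hδ.le hxy hp0.le
    have h2 : |f x - f y| ≤ 2 * M := by
      have := abs_sub (f x) (f y)
      have h3 := hM x
      have h4 := hM y
      rw [Real.norm_eq_abs] at h3 h4
      linarith
    have h3 : 2 * M ≤ 2 * M / δ ^ p * dist x y ^ p := by
      rw [div_mul_eq_mul_div, le_div_iff₀ hδp]
      gcongr
    have : 0 ≤ κ * (persDist x ^ p + persDist y ^ p) := by positivity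
    linarith

lemma integrable_cs {p : ℝ} (hp : 1 ≤ p) {μ : Measure Pt} (hμ : MemMp p μ)
    {f : Pt → ℝ} (hf : Continuous f)
    (hc : HasCompactSupport f) (hs : tsupport f ⊆ UHP) : Integrable f μ := by
  have hp0 : 0 < p := by linarith
  obtain ⟨c, hc0, hcle⟩ := IsCompact.exists_forall_le' (f := persDist) (s := tsupport f) hc
    continuous_persDist.continuousOn (a := 0) (fun b hb => persDist_pos (hs hb))
  obtain ⟨M, hM⟩ := hf.bounded_above_of_compact_support hc
  have hM0 : 0 ≤ M := (norm_nonneg _).trans (hM 0)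
  have hcp : 0 < c ^ p := Real.rpow_pos_of_pos hc0 p
  refine ⟨hf.aestronglyMeasurable, ?_⟩
  have hle : ∀ x, ‖f x‖ₑ ≤ ENNReal.ofReal (M / c ^ p) * wt p x := by
    intro x
    rw [wt, ← ENNReal.ofReal_mul (by positivity), ← ofReal_norm]
    apply ENNReal.ofReal_le_ofReal
    by_cases hx : x ∈ tsupport f
    · have : c ^ p ≤ persDist x ^ p := Real.rpow_le_rpow hc0.le (hcle x hx) hp0.le
      refine (hM x).trans ?_
      rw [div_mul_eq_mul_div, le_div_iff₀ hcp]
      gcongr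
    · rw [image_eq_zero_of_notMem_tsupport hx, norm_zero]
      have := Real.rpow_nonneg (persDist_nonneg x) p
      positivity
  refine (lintegral_mono hle).trans_lt ?_
  rw [lintegral_const_mul _ (measurable_wt p), ← Pers_eq hμ.1]
  exact ENNReal.mul_lt_top ENNReal.ofReal_lt_top hμ.2

lemma Adm_integral {μ ν : Measure Pt} {π : Measure (Pt × Pt)}
    (h : π ∈ Adm μ ν) {f : Pt → ℝ} (hf : Continuous f) (hs : tsupport f ⊆ UHP)
    (hi : Integrable f μ) :
    Integrable (fun z : Pt × Pt => f z.1) π ∧ ∫ z, f z.1 ∂π = ∫ x, f x ∂μ := by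
  have hsup : Function.support f ⊆ UHP := (subset_tsupport f).trans hs
  have hind : UHP.indicator f = f := indicator_eq_self.2 hsup
  constructor
  · have : Integrable f (π.map Prod.fst) := by
      rw [← hind, integrable_indicator_iff isOpen_UHP.measurableSet, IntegrableOn, Adm_restrict h]
      exact hi.restrict
    exact this.comp_measurable measurable_fst
  · rw [← integral_map measurable_fst.aemeasurable hf.aestronglyMeasurable, ← hind,
      integral_indicator isOpen_UHP.measurableSet, integral_indicator isOpen_UHP.measurableSet,
      Adm_restrict h]

lemma vague_bound {p : ℝ} (hp : 1 ≤ p) {μ ν : Measure Pt} (hμ : MemMp p μ) (hν : MemMp p ν)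
    {f : Pt → ℝ} (hf : Continuous f)
    (hc : HasCompactSupport f) (hs : tsupport f ⊆ UHP) {κ C : ℝ} (hκ : 0 < κ) (hC : 0 < C)
    (hb : ∀ x y, |f x - f y| ≤
      κ * (persDist x ^ p + persDist y ^ p) + C * dist x y ^ p) :
    ‖∫ x, f x ∂μ - ∫ x, f x ∂ν‖ₑ ≤
      ENNReal.ofReal κ * (Pers p μ + Pers p ν) + ENNReal.ofReal C * OTe p μ ν := by
  have hp0 : 0 < p := by linarith
  have key : ∀ π ∈ Adm μ ν, ‖∫ x, f x ∂μ - ∫ x, f x ∂ν‖ₑ ≤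
      ENNReal.ofReal κ * (Pers p μ + Pers p ν) + ENNReal.ofReal C * Cost p π := by
    intro π hπ
    obtain ⟨i1, e1⟩ := Adm_integral hπ hf hs (integrable_cs hp hμ hf hc hs)
    obtain ⟨i2, e2⟩ := Adm_integral (Adm_swap hπ) hf hs (integrable_cs hp hν hf hc hs)
    have i3 : Integrable (fun z : Pt × Pt => f z.2) π := i2.comp_measurable measurable_swap
    have e3 : ∫ z, f z.2 ∂π = ∫ x, f x ∂ν := by
      rw [← e2, integral_map measurable_swap.aemeasurable
        (by fun_prop : Continuous fun z : Pt × Pt => f z.1).aestronglyMeasurable]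
      rfl
    rw [← e1, ← e3, ← integral_sub i1 i3]
    refine (enorm_integral_le_lintegral_enorm _).trans ?_
    have hm1 : Measurable fun z : Pt × Pt => wt p z.1 := (measurable_wt p).comp measurable_fst
    have hm2 : Measurable fun z : Pt × Pt => wt p z.2 := (measurable_wt p).comp measurable_snd
    rw [← Adm_wt_fst hp0 hπ, ← Adm_wt_snd hp0 hπ, Cost, ← lintegral_add_left hm1,
      ← lintegral_const_mul _ (by fun_prop), ← lintegral_const_mul _ (by fun_prop),
      ← lintegral_add_left (by fun_prop)]
    refine lintegral_mono fun z => ?_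
    have hx0 : 0 ≤ persDist z.1 ^ p := Real.rpow_nonneg (persDist_nonneg _) _
    have hy0 : 0 ≤ persDist z.2 ^ p := Real.rpow_nonneg (persDist_nonneg _) _
    have hd0 : 0 ≤ dist z.1 z.2 ^ p := Real.rpow_nonneg dist_nonneg _
    simp only [wt]
    rw [← ENNReal.ofReal_add hx0 hy0, ← ENNReal.ofReal_mul hκ.le, ← ENNReal.ofReal_mul hC.le,
      ← ENNReal.ofReal_add (by positivity) (by positivity), ← ofReal_norm]
    exact ENNReal.ofReal_le_ofReal (hb _ _)
  have hC' : ENNReal.ofReal C ≠ 0 := by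
    simp only [ne_eq, ENNReal.ofReal_eq_zero, not_le]
    exact hC
  rw [← tsub_le_iff_left, mul_comm _ (OTe p μ ν), ← ENNReal.div_le_iff hC' ENNReal.ofReal_ne_top]
  refine le_iInf₂ fun π hπ => ?_
  rw [ENNReal.div_le_iff hC' ENNReal.ofReal_ne_top, tsub_le_iff_left, mul_comm (Cost p π)]
  exact key π hπ

lemma vague_of_OTe {p : ℝ} (hp : 1 ≤ p) {μ : Measure Pt} {μs : ℕ → Measure Pt}
    (hμ : MemMp p μ) (hμs : ∀ n, MemMp p (μs n))
    (h : Tendsto (fun n => OTe p (μs n) μ) atTop (𝓝 0)) : VagueTendsto μs μ := by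
  intro f hf hc hs
  have hP := Pers_tendsto hp hμ.2 h
  rw [tendsto_iff_edist_tendsto_0, ENNReal.tendsto_nhds_zero]
  intro ε hε
  -- choose κ
  obtain ⟨κ, hκ, hκε⟩ : ∃ κ : ℝ, 0 < κ ∧ ENNReal.ofReal κ * (Pers p μ + Pers p μ) < ε := by
    have : Tendsto (fun κ : ℝ => ENNReal.ofReal κ * (Pers p μ + Pers p μ)) (𝓝[>] 0) (𝓝 0) := by
      have h1 : Tendsto (fun κ : ℝ => ENNReal.ofReal κ) (𝓝[>] 0) (𝓝 0) := by
        have := (ENNReal.continuous_ofReal.tendsto 0).mono_left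
          (nhdsWithin_le_nhds (s := Ioi (0:ℝ)))
        simpa using this
      simpa using ENNReal.Tendsto.mul_const h1
        (Or.inr (ENNReal.add_lt_top.2 ⟨hμ.2, hμ.2⟩).ne)
    obtain ⟨κ, h1, h2⟩ := ((this.eventually (gt_mem_nhds hε)).and self_mem_nhdsWithin).exists
    exact ⟨κ, h2, h1⟩
  obtain ⟨C, hC, hb⟩ := vague_pointwise hp hf hc hs hκ
  have hb' : ∀ x y, |f x - f y| ≤
      κ * (persDist x ^ p + persDist y ^ p) + (C + 1) * dist x y ^ p := by
    intro x y
    have hd0 : 0 ≤ dist x y ^ p := Real.rpow_nonneg dist_nonneg _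
    linarith [hb x y]
  have ht : Tendsto (fun n => ENNReal.ofReal κ * (Pers p (μs n) + Pers p μ) +
      ENNReal.ofReal (C + 1) * OTe p (μs n) μ) atTop
      (𝓝 (ENNReal.ofReal κ * (Pers p μ + Pers p μ) + ENNReal.ofReal (C + 1) * 0)) := by
    refine Tendsto.add ?_ ?_
    · exact ENNReal.Tendsto.const_mul (hP.add tendsto_const_nhds) (Or.inr ENNReal.ofReal_ne_top)
    · exact ENNReal.Tendsto.const_mul h (Or.inr ENNReal.ofReal_ne_top)
  rw [mul_zero, add_zero] at ht
  filter_upwards [ht.eventually (gt_mem_nhds hκε)] with n hn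
  rw [edist_eq_enorm_sub]
  exact (vague_bound hp (hμs n) hμ hf hc hs hκ (by linarith) hb').trans hn.le

lemma mass_split {N : ℕ} (μ : Measure Pt) (t : Fin N → ℝ≥0∞) (φ : Fin N → Pt → ℝ≥0∞)
    (hφ : ∀ i, Measurable (φ i)) (h1 : ∀ x, ∑ i, t i * φ i x ≤ 1) {A : Set Pt}
    (hA : MeasurableSet A) :
    ∑ i, t i * (μ.withDensity (φ i)) A + μ.withDensity (fun x => 1 - ∑ i, t i * φ i x) A
      = μ A := by
  simp_rw [withDensity_apply _ hA]
  simp_rw [← lintegral_const_mul _ (hφ _)]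
  rw [← lintegral_finsetSum _ (by fun_prop), ← lintegral_add_left (by fun_prop)]
  have : ∀ x, ∑ i, t i * φ i x + (1 - ∑ i, t i * φ i x) = 1 := fun x =>
    add_tsub_cancel_of_le (h1 x)
  simp [this]

lemma weight_le_one (a b : ℝ≥0∞) : (max a b)⁻¹ * a ≤ 1 := by
  rw [mul_comm, ← div_eq_mul_inv]
  exact ENNReal.div_le_of_le_mul (by simp)

/-- The explicit plan bound. -/
lemma OTe_le_plan {p : ℝ} (hp : 1 ≤ p) {μ ν : Measure Pt} (hμ : μ UHPᶜ = 0) (hν : ν UHPᶜ = 0)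
    {N : ℕ} (φ : Fin N → Pt → ℝ≥0∞) (hφ : ∀ i, Measurable (φ i)) (h1 : ∀ x, ∑ i, φ i x ≤ 1)
    (a b : Fin N → ℝ≥0∞) (ha : ∀ i, ∫⁻ x, φ i x ∂μ = a i) (hb : ∀ i, ∫⁻ x, φ i x ∂ν = b i)
    (ha' : ∀ i, a i ≠ ⊤) (hb' : ∀ i, b i ≠ ⊤)
    {ε : ℝ} (hd : ∀ i x y, φ i x ≠ 0 → φ i y ≠ 0 → dist x y ≤ ε) :
    OTe p μ ν ≤ ENNReal.ofReal (ε ^ p) * ∑ i, b i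
      + ∫⁻ x, (1 - ∑ i, (max (a i) (b i))⁻¹ * b i * φ i x) * wt p x ∂μ
      + ∫⁻ x, (1 - ∑ i, (max (a i) (b i))⁻¹ * a i * φ i x) * wt p x ∂ν := by
  have hp0 : 0 < p := by linarith
  have hwt := measurable_wt p
  have hprD := continuous_prD.measurable
  set c : Fin N → ℝ≥0∞ := fun i => (max (a i) (b i))⁻¹ with hc
  have hca : ∀ i, c i * a i ≤ 1 := fun i => weight_le_one _ _
  have hcb : ∀ i, c i * b i ≤ 1 := fun i => by
    have := weight_le_one (b i) (a i)
    rwa [max_comm] at this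
  have hh : ∀ x, ∑ i, c i * b i * φ i x ≤ 1 := fun x =>
    (Finset.sum_le_sum fun i _ => mul_le_of_le_one_left zero_le (hcb i)).trans (h1 x)
  have hk : ∀ x, ∑ i, c i * a i * φ i x ≤ 1 := fun x =>
    (Finset.sum_le_sum fun i _ => mul_le_of_le_one_left zero_le (hca i)).trans (h1 x)
  set α : Fin N → Measure Pt := fun i => μ.withDensity (φ i) with hα
  set β : Fin N → Measure Pt := fun i => ν.withDensity (φ i) with hβ
  have hαu : ∀ i, α i univ = a i := fun i => by simp [hα, withDensity_apply, ha]
  have hβu : ∀ i, β i univ = b i := fun i => by simp [hβ, withDensity_apply, hb]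
  have : ∀ i, IsFiniteMeasure (α i) := fun i => ⟨by rw [hαu]; exact (ha' i).lt_top⟩
  have : ∀ i, IsFiniteMeasure (β i) := fun i => ⟨by rw [hβu]; exact (hb' i).lt_top⟩
  set r : Measure Pt := μ.withDensity (fun x => 1 - ∑ i, c i * b i * φ i x) with hr
  set s : Measure Pt := ν.withDensity (fun x => 1 - ∑ i, c i * a i * φ i x) with hs
  have mr : Measurable fun x : Pt => (x, prD x) := by fun_prop
  have ms : Measurable fun x : Pt => (prD x, x) := by fun_prop
  set π : Measure (Pt × Pt) := ∑ i, c i • (α i).prod (β i) + r.map (fun x => (x, prD x))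
    + s.map (fun x => (prD x, x)) with hπ
  have πapp : ∀ S, MeasurableSet S → π S = ∑ i, c i * (α i).prod (β i) S
      + r ((fun x => (x, prD x)) ⁻¹' S) + s ((fun x => (prD x, x)) ⁻¹' S) := by
    intro S hS
    rw [hπ, Measure.add_apply, Measure.add_apply, Measure.finsetSum_apply,
      Measure.map_apply mr hS, Measure.map_apply ms hS]
    simp
  have acr : r ≪ μ := withDensity_absolutelyContinuous _ _
  have acs : s ≪ ν := withDensity_absolutelyContinuous _ _
  have hDU : ∀ x, prD x ∈ UHP → False := by
    intro x hx
    have := persDist_pos hx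
    rw [persDist_Diag (prD_mem x)] at this
    exact lt_irrefl _ this
  have hDbar : ∀ x, prD x ∈ UHPbar := fun x => Or.inr (prD_mem x)
  have hbarc : UHPbarᶜ ⊆ UHPᶜ := compl_subset_compl.2 subset_union_left
  have hadm : π ∈ Adm μ ν := by
    refine ⟨?_, ?_, ?_⟩
    · rw [πapp _ (measurableSet_UHPbar.prod measurableSet_UHPbar).compl]
      have z1 : ∀ i, (α i).prod (β i) (UHPbar ×ˢ UHPbar)ᶜ = 0 := by
        intro i
        have ha0 : α i UHPbarᶜ = 0 :=
          (withDensity_absolutelyContinuous μ (φ i)) (measure_mono_null hbarc hμ)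
        have hb0 : β i UHPbarᶜ = 0 :=
          (withDensity_absolutelyContinuous ν (φ i)) (measure_mono_null hbarc hν)
        rw [compl_prod_eq_union]
        refine measure_union_null ?_ ?_
        · rw [Measure.prod_prod, ha0, zero_mul]
        · rw [Measure.prod_prod, hb0, mul_zero]
      have z2 : r ((fun x => (x, prD x)) ⁻¹' (UHPbar ×ˢ UHPbar)ᶜ) = 0 := by
        refine acr (measure_mono_null ?_ hμ)
        intro x hx
        apply hbarc
        intro hx'
        exact hx ⟨hx', hDbar x⟩
      have z3 : s ((fun x => (prD x, x)) ⁻¹' (UHPbar ×ˢ UHPbar)ᶜ) = 0 := by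
        refine acs (measure_mono_null ?_ hν)
        intro x hx
        apply hbarc
        intro hx'
        exact hx ⟨hDbar x, hx'⟩
      rw [z2, z3]
      simp [z1]
    · intro A hA hAU
      rw [πapp _ (hA.prod MeasurableSet.univ)]
      have z3 : (fun x : Pt => (prD x, x)) ⁻¹' (A ×ˢ univ) = ∅ := by
        ext x; simp only [mem_preimage, mem_prod, mem_univ, and_true, mem_empty_iff_false, iff_false]
        exact fun h => hDU x (hAU h)
      have z2 : (fun x : Pt => (x, prD x)) ⁻¹' (A ×ˢ univ) = A := by ext x; simp
      rw [z3, z2, measure_empty, add_zero]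
      simp_rw [Measure.prod_prod, hβu]
      rw [← mass_split μ (fun i => c i * b i) φ hφ hh hA]
      congr 1
      exact Finset.sum_congr rfl fun i _ => by ring
    · intro A hA hAU
      rw [πapp _ (MeasurableSet.univ.prod hA)]
      have z3 : (fun x : Pt => (x, prD x)) ⁻¹' (univ ×ˢ A) = ∅ := by
        ext x; simp only [mem_preimage, mem_prod, mem_univ, true_and, mem_empty_iff_false, iff_false]
        exact fun h => hDU x (hAU h)
      have z2 : (fun x : Pt => (prD x, x)) ⁻¹' (univ ×ˢ A) = A := by ext x; simp
      rw [z3, z2, measure_empty, add_zero]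
      simp_rw [Measure.prod_prod, hαu]
      rw [← mass_split ν (fun i => c i * a i) φ hφ hk hA]
      congr 1
      exact Finset.sum_congr rfl fun i _ => by ring
  refine (iInf₂_le π hadm).trans ?_
  have hmc : Measurable fun z : Pt × Pt => ENNReal.ofReal (dist z.1 z.2 ^ p) := by fun_prop
  have hcost : ∀ x, ENNReal.ofReal (dist x (prD x) ^ p) ≤ wt p x := fun x =>
    ENNReal.ofReal_le_ofReal (Real.rpow_le_rpow dist_nonneg (dist_prD x) hp0.le)
  unfold Cost
  rw [hπ, lintegral_add_measure, lintegral_add_measure, lintegral_finsetSum_measure,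
    lintegral_map hmc mr, lintegral_map hmc ms]
  gcongr ?_ + ?_ + ?_
  · rw [Finset.mul_sum]
    refine Finset.sum_le_sum fun i _ => ?_
    rw [lintegral_smul_measure, smul_eq_mul]
    have e1 : ∫⁻ z, ENNReal.ofReal (dist z.1 z.2 ^ p) ∂(α i).prod (β i)
        ≤ ENNReal.ofReal (ε ^ p) * (a i * b i) := by
      have : ∫⁻ z, ENNReal.ofReal (ε ^ p) ∂(α i).prod (β i)
          = ENNReal.ofReal (ε ^ p) * (a i * b i) := by
        rw [lintegral_const, ← univ_prod_univ, Measure.prod_prod, hαu, hβu]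
      rw [← this]
      refine lintegral_mono_ae ?_
      have q1 : ∀ᵐ x ∂(α i), φ i x ≠ 0 := by
        rw [hα, ae_withDensity_iff (hφ i)]
        exact Eventually.of_forall fun x hx => hx
      have q2 : ∀ᵐ x ∂(β i), φ i x ≠ 0 := by
        rw [hβ, ae_withDensity_iff (hφ i)]
        exact Eventually.of_forall fun x hx => hx
      filter_upwards [Measure.quasiMeasurePreserving_fst.ae q1,
        Measure.quasiMeasurePreserving_snd.ae q2] with z hz1 hz2
      exact ENNReal.ofReal_le_ofReal
        (Real.rpow_le_rpow dist_nonneg (hd i _ _ hz1 hz2) hp0.le)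
    calc c i * _ ≤ c i * (ENNReal.ofReal (ε ^ p) * (a i * b i)) := by gcongr
      _ = (c i * a i) * (ENNReal.ofReal (ε ^ p) * b i) := by ring
      _ ≤ 1 * (ENNReal.ofReal (ε ^ p) * b i) := by gcongr; exact hca i
      _ = _ := one_mul _
  · have e := lintegral_withDensity_eq_lintegral_mul μ
      (f := fun x => 1 - ∑ i, c i * b i * φ i x) (by fun_prop) hwt
    exact (lintegral_mono hcost).trans_eq e
  · have e := lintegral_withDensity_eq_lintegral_mul ν
      (f := fun x => 1 - ∑ i, c i * a i * φ i x) (by fun_prop) hwt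
    refine (lintegral_mono fun x => ?_).trans_eq e
    simp only [dist_comm (prD x) x]
    exact hcost x

lemma rem_eq {p : ℝ} {μ : Measure Pt} (hμ : MemMp p μ) {N : ℕ} (t : Fin N → ℝ≥0∞)
    (φ : Fin N → Pt → ℝ≥0∞) (hφ : ∀ i, Measurable (φ i)) (h1 : ∀ x, ∑ i, t i * φ i x ≤ 1) :
    ∫⁻ x, (1 - ∑ i, t i * φ i x) * wt p x ∂μ
      = Pers p μ - ∑ i, t i * ∫⁻ x, φ i x * wt p x ∂μ := by
  have hwt := measurable_wt p
  have e : ∑ i, t i * ∫⁻ x, φ i x * wt p x ∂μ = ∫⁻ x, (∑ i, t i * φ i x) * wt p x ∂μ := by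
    simp_rw [Finset.sum_mul, mul_assoc]
    rw [lintegral_finsetSum _ (by fun_prop)]
    refine Finset.sum_congr rfl fun i _ => ?_
    rw [lintegral_const_mul _ (by fun_prop)]
  have hle : ∀ x, (∑ i, t i * φ i x) * wt p x ≤ wt p x := fun x =>
    mul_le_of_le_one_left zero_le (h1 x)
  rw [e, Pers_eq hμ.1, ← lintegral_sub (by fun_prop) _ (Eventually.of_forall hle)]
  · refine lintegral_congr fun x => ?_
    rw [ENNReal.sub_mul (fun _ _ => by unfold wt; exact ENNReal.ofReal_ne_top), one_mul]
  · have := hμ.2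
    rw [Pers_eq hμ.1] at this
    exact ((lintegral_mono hle).trans_lt this).ne

/-- Partition of a bump function into small cells. -/
lemma exists_cells {χ : Pt → ℝ} (hχ : Continuous χ) (hc : HasCompactSupport χ)
    (h0 : ∀ x, 0 ≤ χ x) {ε : ℝ} (hε : 0 < ε) :
    ∃ (N : ℕ) (φ : Fin N → Pt → ℝ), (∀ i, Continuous (φ i)) ∧ (∀ i, HasCompactSupport (φ i)) ∧
      (∀ i, tsupport (φ i) ⊆ tsupport χ) ∧ (∀ i x, 0 ≤ φ i x) ∧ (∀ x, ∑ i, φ i x = χ x) ∧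
      (∀ i x y, φ i x ≠ 0 → φ i y ≠ 0 → dist x y ≤ ε) := by
  obtain ⟨t, -, htf, hcov⟩ := hc.isCompact.finite_cover_balls (half_pos hε)
  have := htf.fintype
  let e := Fintype.equivFin t
  obtain ⟨ψ, hψs, hψ1, hψ01, -⟩ := exists_continuous_sum_one_of_isOpen_isCompact
    (s := fun i => ball ((e.symm i : t) : Pt) (ε / 2)) (fun i => isOpen_ball) hc.isCompact (by
      intro x hx
      obtain ⟨y, hy, hxy⟩ := mem_iUnion₂.1 (hcov hx)
      exact mem_iUnion.2 ⟨e ⟨y, hy⟩, by simpa using hxy⟩)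
  refine ⟨_, fun i x => χ x * ψ i x, fun i => hχ.mul (ψ i).continuous, fun i => hc.mul_right,
    fun i => tsupport_mul_subset_left, fun i x => mul_nonneg (h0 x) (hψ01 i x).1, ?_, ?_⟩
  · intro x
    rw [← Finset.mul_sum]
    by_cases hx : x ∈ tsupport χ
    · have := hψ1 hx
      simp only [Finset.sum_apply, Pi.one_apply] at this
      rw [this, mul_one]
    · rw [image_eq_zero_of_notMem_tsupport hx, zero_mul]
  · intro i x y hx hy
    have h1 := hψs i (subset_tsupport _ (right_ne_zero_of_mul hx))
    have h2 := hψs i (subset_tsupport _ (right_ne_zero_of_mul hy))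
    rw [mem_ball] at h1 h2
    have := dist_triangle_right x y ((e.symm i : t) : Pt)
    linarith

lemma vague_lintegral {p : ℝ} (hp : 1 ≤ p) {μ : Measure Pt} {μs : ℕ → Measure Pt}
    (hμ : MemMp p μ) (hμs : ∀ n, MemMp p (μs n)) (h : VagueTendsto μs μ)
    {f : Pt → ℝ} (hf : Continuous f) (hc : HasCompactSupport f) (hs : tsupport f ⊆ UHP)
    (h0 : ∀ x, 0 ≤ f x) :
    Tendsto (fun n => ∫⁻ x, ENNReal.ofReal (f x) ∂(μs n)) atTop
      (𝓝 (∫⁻ x, ENNReal.ofReal (f x) ∂μ)) := by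
  have e : ∀ ν, MemMp p ν → ∫⁻ x, ENNReal.ofReal (f x) ∂ν = ENNReal.ofReal (∫ x, f x ∂ν) :=
    fun ν hν => (ofReal_integral_eq_lintegral_ofReal (integrable_cs hp hν hf hc hs)
      (Eventually.of_forall h0)).symm
  rw [e μ hμ]
  simp_rw [e _ (hμs _)]
  exact (ENNReal.continuous_ofReal.tendsto _).comp (h f hf hc hs)

lemma lintegral_cs_ne_top {p : ℝ} (hp : 1 ≤ p) {μ : Measure Pt} (hμ : MemMp p μ)
    {f : Pt → ℝ} (hf : Continuous f) (hc : HasCompactSupport f) (hs : tsupport f ⊆ UHP)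
    (h0 : ∀ x, 0 ≤ f x) : ∫⁻ x, ENNReal.ofReal (f x) ∂μ ≠ ⊤ := by
  rw [← ofReal_integral_eq_lintegral_ofReal (integrable_cs hp hμ hf hc hs)
      (Eventually.of_forall h0)]
  exact ENNReal.ofReal_ne_top

lemma exists_bump {p : ℝ} {μ : Measure Pt} (hμ : MemMp p μ) {η : ℝ≥0∞} (hη : 0 < η) :
    ∃ χ : Pt → ℝ, Continuous χ ∧ HasCompactSupport χ ∧ tsupport χ ⊆ UHP ∧
      (∀ x, 0 ≤ χ x) ∧ (∀ x, χ x ≤ 1) ∧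
      ∫⁻ x, (1 - ENNReal.ofReal (χ x)) * wt p x ∂μ < η := by
  have hwt := measurable_wt p
  set w : Measure Pt := μ.withDensity (wt p) with hw
  have hfin : w univ < ⊤ := by
    rw [hw, withDensity_apply _ MeasurableSet.univ, Measure.restrict_univ, ← Pers_eq hμ.1]
    exact hμ.2
  have : IsFiniteMeasure w := ⟨hfin⟩
  obtain ⟨K, hKU, hK, hlt⟩ := isOpen_UHP.measurableSet.exists_isCompact_sdiff_lt (μ := w)
    (measure_ne_top _ _) hη.ne'
  obtain ⟨χ, h1, h2, h3, h4⟩ := exists_continuousMap_one_of_isCompact_subset_isOpen hK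
    isOpen_UHP hKU
  refine ⟨χ, χ.continuous, h2, h3, fun x => (h4 x).1, fun x => (h4 x).2, ?_⟩
  refine lt_of_le_of_lt ?_ hlt
  have hle : ∫⁻ x, (1 - ENNReal.ofReal (χ x)) * wt p x ∂μ ≤ w Kᶜ := by
    rw [hw, withDensity_apply _ hK.measurableSet.compl,
      ← lintegral_indicator hK.measurableSet.compl]
    refine lintegral_mono fun x => ?_
    by_cases hx : x ∈ K
    · simp [hx, h1 hx]
    · simp only [indicator, mem_compl_iff, hx, not_false_eq_true, if_true]
      exact mul_le_of_le_one_left zero_le tsub_le_self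
  refine hle.trans ?_
  have hz : w UHPᶜ = 0 := withDensity_absolutelyContinuous _ _ hμ.1
  calc w Kᶜ ≤ w ((UHP \ K) ∪ UHPᶜ) := by
        refine measure_mono fun x hx => ?_
        by_cases h : x ∈ UHP
        · exact Or.inl ⟨h, hx⟩
        · exact Or.inr h
    _ ≤ w (UHP \ K) + w UHPᶜ := measure_union_le _ _
    _ = w (UHP \ K) := by rw [hz, add_zero]

lemma OTe_tendsto {p : ℝ} (hp : 1 ≤ p) {μ : Measure Pt} {μs : ℕ → Measure Pt}
    (hμ : MemMp p μ) (hμs : ∀ n, MemMp p (μs n)) (hv : VagueTendsto μs μ)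
    (hP : Tendsto (fun n => Pers p (μs n)) atTop (𝓝 (Pers p μ))) :
    Tendsto (fun n => OTe p (μs n) μ) atTop (𝓝 0) := by
  have hp0 : 0 < p := by linarith
  rw [ENNReal.tendsto_nhds_zero]
  intro ε₀ hε₀
  have hη : 0 < ε₀ / 3 := ENNReal.div_pos hε₀.ne' (by simp)
  obtain ⟨χ, hχc, hχs, hχU, hχ0, hχ1, hχη⟩ := exists_bump hμ hη
  have hχfin := lintegral_cs_ne_top hp hμ hχc hχs hχU hχ0
  obtain ⟨ε, hε, hεη⟩ : ∃ ε : ℝ, 0 < ε ∧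
      ENNReal.ofReal (ε ^ p) * ∫⁻ x, ENNReal.ofReal (χ x) ∂μ < ε₀ / 3 := by
    have h1 : Tendsto (fun ε : ℝ => ENNReal.ofReal (ε ^ p)) (𝓝[>] 0) (𝓝 0) := by
      have h2 : Continuous fun ε : ℝ => ENNReal.ofReal (ε ^ p) :=
        ENNReal.continuous_ofReal.comp (Real.continuous_rpow_const hp0.le)
      have := (h2.tendsto 0).mono_left (nhdsWithin_le_nhds (s := Ioi (0:ℝ)))
      simpa [Real.zero_rpow hp0.ne'] using this
    have h3 := ENNReal.Tendsto.mul_const h1 (Or.inr hχfin)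
    rw [zero_mul] at h3
    obtain ⟨ε, h4, h5⟩ := ((h3.eventually (gt_mem_nhds hη)).and self_mem_nhdsWithin).exists
    exact ⟨ε, h5, h4⟩
  obtain ⟨N, φ, φc, φs, φsup, φ0, φsum, φd⟩ := exists_cells hχc hχs hχ0 hε
  have φU : ∀ i, tsupport (φ i) ⊆ UHP := fun i => (φsup i).trans hχU
  set Φ : Fin N → Pt → ℝ≥0∞ := fun i x => ENNReal.ofReal (φ i x) with hΦ
  have Φm : ∀ i, Measurable (Φ i) := fun i =>
    ENNReal.measurable_ofReal.comp (φc i).measurable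
  have Φsum : ∀ x, ∑ i, Φ i x = ENNReal.ofReal (χ x) := by
    intro x
    rw [← φsum, ENNReal.ofReal_sum_of_nonneg (fun i _ => φ0 i x)]
  have Φ1 : ∀ x, ∑ i, Φ i x ≤ 1 := by
    intro x
    rw [Φsum]
    exact ENNReal.ofReal_le_one.2 (hχ1 x)
  have Φd : ∀ i x y, Φ i x ≠ 0 → Φ i y ≠ 0 → dist x y ≤ ε := by
    intro i x y hx hy
    refine φd i x y (fun h => hx ?_) (fun h => hy ?_)
    · simp [hΦ, h]
    · simp [hΦ, h]
  -- masses
  set a : ℕ → Fin N → ℝ≥0∞ := fun n i => ∫⁻ x, Φ i x ∂(μs n) with ha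
  set b : Fin N → ℝ≥0∞ := fun i => ∫⁻ x, Φ i x ∂μ with hb
  have hafin : ∀ n i, a n i ≠ ⊤ := fun n i =>
    lintegral_cs_ne_top hp (hμs n) (φc i) (φs i) (φU i) (φ0 i)
  have hbfin : ∀ i, b i ≠ ⊤ := fun i => lintegral_cs_ne_top hp hμ (φc i) (φs i) (φU i) (φ0 i)
  have hab : ∀ i, Tendsto (fun n => a n i) atTop (𝓝 (b i)) := fun i =>
    vague_lintegral hp hμ hμs hv (φc i) (φs i) (φU i) (φ0 i)
  -- weighted masses
  set A : ℕ → Fin N → ℝ≥0∞ := fun n i => ∫⁻ x, Φ i x * wt p x ∂(μs n) with hA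
  set B : Fin N → ℝ≥0∞ := fun i => ∫⁻ x, Φ i x * wt p x ∂μ with hB
  have hw0 : ∀ i x, 0 ≤ φ i x * persDist x ^ p := fun i x =>
    mul_nonneg (φ0 i x) (Real.rpow_nonneg (persDist_nonneg _) _)
  have hΦw : ∀ i x, Φ i x * wt p x = ENNReal.ofReal (φ i x * persDist x ^ p) := by
    intro i x
    rw [ENNReal.ofReal_mul (φ0 i x)]
    rfl
  have hwc : ∀ i, Continuous fun x => φ i x * persDist x ^ p := fun i =>
    (φc i).mul ((Real.continuous_rpow_const hp0.le).comp continuous_persDist)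
  have hws : ∀ i, HasCompactSupport fun x => φ i x * persDist x ^ p := fun i => (φs i).mul_right
  have hwU : ∀ i, tsupport (fun x => φ i x * persDist x ^ p) ⊆ UHP := fun i =>
    (tsupport_mul_subset_left (f := φ i)).trans (φU i)
  have hAB : ∀ i, Tendsto (fun n => A n i) atTop (𝓝 (B i)) := by
    intro i
    simp only [hA, hB, hΦw]
    exact vague_lintegral hp hμ hμs hv (hwc i) (hws i) (hwU i) (hw0 i)
  have hBfin : ∀ i, B i ≠ ⊤ := by
    intro i
    simp only [hB, hΦw]
    exact lintegral_cs_ne_top hp hμ (hwc i) (hws i) (hwU i) (hw0 i)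
  have hB0 : ∀ i, b i = 0 → B i = 0 := by
    intro i hi
    rw [hb, lintegral_eq_zero_iff (Φm i)] at hi
    refine (lintegral_eq_zero_iff ((Φm i).mul (measurable_wt p))).2 ?_
    filter_upwards [hi] with x hx
    simp only [Pi.zero_apply, Pi.mul_apply] at hx ⊢
    rw [hx, zero_mul]
  have hinv : ∀ i, Tendsto (fun n => (max (a n i) (b i))⁻¹) atTop (𝓝 (b i)⁻¹) := by
    intro i
    have := (hab i).max (tendsto_const_nhds (x := b i))
    rw [max_self] at this
    exact tendsto_inv_iff.2 this
  have L1 : ∀ i, Tendsto (fun n => (max (a n i) (b i))⁻¹ * b i * A n i) atTop (𝓝 (B i)) := by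
    intro i
    by_cases hi : b i = 0
    · simp [hB0 i hi, hi]
    · have h1 := ENNReal.Tendsto.mul_const (hinv i) (Or.inr (hbfin i))
      rw [ENNReal.inv_mul_cancel hi (hbfin i)] at h1
      have := ENNReal.Tendsto.mul h1 (Or.inl one_ne_zero) (hAB i) (Or.inr ENNReal.one_ne_top)
      rwa [one_mul] at this
  have L2 : ∀ i, Tendsto (fun n => (max (a n i) (b i))⁻¹ * a n i * B i) atTop (𝓝 (B i)) := by
    intro i
    by_cases hi : b i = 0
    · simp [hB0 i hi]
    · have h1 := ENNReal.Tendsto.mul (hinv i) (Or.inr (hbfin i)) (hab i)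
        (Or.inr (ENNReal.inv_ne_top.2 hi))
      rw [ENNReal.inv_mul_cancel hi (hbfin i)] at h1
      have := ENNReal.Tendsto.mul_const h1 (Or.inr (hBfin i))
      rwa [one_mul] at this
  have hbound : ∀ n, OTe p (μs n) μ ≤ ENNReal.ofReal (ε ^ p) * ∑ i, b i
      + (Pers p (μs n) - ∑ i, (max (a n i) (b i))⁻¹ * b i * A n i)
      + (Pers p μ - ∑ i, (max (a n i) (b i))⁻¹ * a n i * B i) := by
    intro n
    refine (OTe_le_plan hp (hμs n).1 hμ.1 Φ Φm Φ1 (a n) b (fun i => rfl) (fun i => rfl)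
      (hafin n) hbfin Φd).trans_eq ?_
    rw [rem_eq (hμs n) (fun i => (max (a n i) (b i))⁻¹ * b i) Φ Φm,
      rem_eq hμ (fun i => (max (a n i) (b i))⁻¹ * a n i) Φ Φm]
    · intro x
      exact (Finset.sum_le_sum fun i _ => mul_le_of_le_one_left zero_le
        (weight_le_one _ _)).trans (Φ1 x)
    · intro x
      refine (Finset.sum_le_sum fun i _ => mul_le_of_le_one_left zero_le ?_).trans (Φ1 x)
      rw [max_comm]
      exact weight_le_one _ _
  have hrem : Pers p μ - ∑ i, B i < ε₀ / 3 := by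
    have := rem_eq hμ (fun _ => 1) Φ Φm (by simpa using Φ1)
    simp only [one_mul, Φsum] at this
    rw [← this]
    exact hχη
  have hbs : ∑ i, b i = ∫⁻ x, ENNReal.ofReal (χ x) ∂μ := by
    rw [hb, ← lintegral_finsetSum _ (fun i _ => Φm i)]
    simp_rw [Φsum]
  have hlim : Tendsto (fun n => ENNReal.ofReal (ε ^ p) * ∑ i, b i
      + (Pers p (μs n) - ∑ i, (max (a n i) (b i))⁻¹ * b i * A n i)
      + (Pers p μ - ∑ i, (max (a n i) (b i))⁻¹ * a n i * B i)) atTop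
      (𝓝 (ENNReal.ofReal (ε ^ p) * ∑ i, b i + (Pers p μ - ∑ i, B i)
        + (Pers p μ - ∑ i, B i))) := by
    refine (tendsto_const_nhds.add ?_).add ?_
    · exact ENNReal.Tendsto.sub hP (tendsto_finsetSum _ fun i _ => L1 i) (Or.inl hμ.2.ne)
    · exact ENNReal.Tendsto.sub tendsto_const_nhds (tendsto_finsetSum _ fun i _ => L2 i)
        (Or.inl hμ.2.ne)
  have hlt : ENNReal.ofReal (ε ^ p) * ∑ i, b i + (Pers p μ - ∑ i, B i)
        + (Pers p μ - ∑ i, B i) < ε₀ := by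
    rw [← ENNReal.add_thirds ε₀, hbs]
    exact ENNReal.add_lt_add (ENNReal.add_lt_add hεη hrem) hrem
  filter_upwards [hlim.eventually (gt_mem_nhds hlt)] with n hn
  exact (hbound n).trans hn.le

/-- OT_p(μ_n,μ) → 0 iff μ_n → μ vaguely and Pers_p(μ_n) → Pers_p(μ). -/
theorem stmt7 (p : ℝ) (hp : 1 ≤ p) (μ : Measure Pt) (μs : ℕ → Measure Pt)
    (hμ : MemMp p μ) (hμs : ∀ n, MemMp p (μs n)) :
    Tendsto (fun n => OTe p (μs n) μ) atTop (𝓝 0) ↔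
      (VagueTendsto μs μ ∧ Tendsto (fun n => Pers p (μs n)) atTop (𝓝 (Pers p μ))) := by
  constructor
  · intro h
    exact ⟨vague_of_OTe hp hμ hμs h, Pers_tendsto hp hμ.2 h⟩
  · rintro ⟨hv, hP⟩
    exact OTe_tendsto hp hμ hμs hv hP
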